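/- Under Assumption (A), suppose d ≤ γn where γ = c·(m/M ∧ m²/(L·√M))² for a small enough absolute constant c > 0. Then there is an absolute constant C such that ‖ ‖θ̂ − θ‖ ∧ m/(12L) ‖_{ψ_2} ≤ C·( (√M/m)·√(d/n) + (m/(L·√γ))·(1/√n) ). -/

import Mathlib

open MeasureTheory Real
open scoped RealInnerProductSpace BigOperators ENNReal NNReal

noncomputable section

abbrev Euc (d : ℕ) : Type := EuclideanSpace ℝ (Fin d)

/-- The noise distribution with density `e^{-V(x)}` w.r.t. Lebesgue measure. -/
def noiseMeasure {d : ℕ} (V : Euc d → ℝ) : Measure (Euc d) :=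
  MeasureTheory.volume.withDensity fun x => ENNReal.ofReal (Real.exp (-(V x)))

/-- The joint distribution of an i.i.d. sample `X_1, …, X_n` from `P_θ(dx) = e^{-V(x-θ)}dx`. -/
def sampleMeasure {d : ℕ} (V : Euc d → ℝ) (n : ℕ) (θ : Euc d) : Measure (Fin n → Euc d) :=
  Measure.pi fun _ => (noiseMeasure V).map (fun x => θ + x)

/-- `ψ_α`-norm of a random variable: `sup_{p ≥ 1} p^{-1/α} (E|η|^p)^{1/p}`. -/
def psiNorm {Ω : Type*} [MeasurableSpace Ω] (α : ℝ) (μ : Measure Ω) (η : Ω → ℝ) : ℝ :=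
  ⨆ p : {p : ℝ // 1 ≤ p}, (p : ℝ) ^ (-(1 / α)) * (∫ ω, |η ω| ^ (p : ℝ) ∂μ) ^ ((1 : ℝ) / (p : ℝ))

/-- `f` belongs to the Hölder ball of radius `B` in `C^s`, `s = l + ρ`. -/
def holderCLe {d : ℕ} (l : ℕ) (ρ : ℝ) (f : Euc d → ℝ) (B : ℝ) : Prop :=
  ContDiff ℝ l f ∧
  (∀ j : ℕ, j ≤ l → ∀ x, ‖iteratedFDeriv ℝ j f x‖ ≤ B) ∧
  (∀ x y, ‖iteratedFDeriv ℝ l f x - iteratedFDeriv ℝ l f y‖ ≤ B * ‖x - y‖ ^ ρ)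

/-- The operator `(T g)(θ) = E_θ g(θ̂)`. -/
def Texp {d : ℕ} (V : Euc d → ℝ) (n : ℕ) (hatθ : (Fin n → Euc d) → Euc d) (g : Euc d → ℝ) :
    Euc d → ℝ :=
  fun θ => ∫ x, g (hatθ x) ∂ sampleMeasure V n θ

/-- The operator `𝓑 = 𝓣 - Id`. -/
def Bop {d : ℕ} (V : Euc d → ℝ) (n : ℕ) (hatθ : (Fin n → Euc d) → Euc d) :
    (Euc d → ℝ) → Euc d → ℝ :=
  fun g θ => Texp V n hatθ g θ - g θ

/-- The bias-corrected functional `f_k = Σ_{j=0}^k (-1)^j 𝓑^j f`. -/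
def biasCorrect {d : ℕ} (V : Euc d → ℝ) (n : ℕ) (hatθ : (Fin n → Euc d) → Euc d) (k : ℕ)
    (f : Euc d → ℝ) : Euc d → ℝ :=
  fun θ => ∑ j ∈ Finset.range (k + 1), (-1 : ℝ) ^ j * (Bop V n hatθ)^[j] f θ

/-- The Poincaré constant `c(V)` of the distribution `e^{-V(x)}dx`. -/
def poincareConst {d : ℕ} (V : Euc d → ℝ) : ℝ :=
  sInf {C : ℝ | 0 ≤ C ∧ ∀ g : Euc d → ℝ, LocallyLipschitz g →
    ∫ x, (g x - ∫ y, g y ∂ noiseMeasure V) ^ 2 ∂ noiseMeasure V ≤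
      C * ∫ x, ‖gradient g x‖ ^ 2 ∂ noiseMeasure V}

/-- Lower bound from Taylor's formula of order two on `[0, 1]`. -/
lemma second_order_lower_bound {φ φ' φ'' : ℝ → ℝ} {K : ℝ}
    (h1 : ∀ s, HasDerivAt φ (φ' s) s) (h2 : ∀ s, HasDerivAt φ' (φ'' s) s)
    (hK : ∀ s ∈ Set.Icc (0 : ℝ) 1, K ≤ φ'' s) :
    φ 0 + φ' 0 + K / 2 ≤ φ 1 := by
  have step1 : ∀ s ∈ Set.Icc (0 : ℝ) 1, φ' 0 + K * s ≤ φ' s := by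
    have hmono : MonotoneOn (fun s => φ' s - K * s) (Set.Icc (0 : ℝ) 1) := by
      have hd : ∀ s, HasDerivAt (fun s => φ' s - K * s) (φ'' s - K) s := fun s =>
        ((h2 s).sub ((hasDerivAt_id s).const_mul K)).congr_deriv (by simp)
      refine monotoneOn_of_deriv_nonneg (convex_Icc 0 1)
        (fun s _ => (hd s).continuousAt.continuousWithinAt)
        (fun s _ => (hd s).differentiableAt.differentiableWithinAt) fun s hs => ?_
      rw [(hd s).deriv]
      exact sub_nonneg.2 (hK s (interior_subset hs))
    intro s hs
    have := hmono (Set.left_mem_Icc.2 zero_le_one) hs hs.1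
    simp only [mul_zero, sub_zero] at this
    linarith
  have hmono : MonotoneOn (fun s => φ s - (φ' 0 * s + K / 2 * s ^ 2)) (Set.Icc (0 : ℝ) 1) := by
    have hd : ∀ s, HasDerivAt (fun s => φ s - (φ' 0 * s + K / 2 * s ^ 2))
        (φ' s - (φ' 0 + K * s)) s := fun s => by
      refine ((h1 s).sub (((hasDerivAt_id s).const_mul (φ' 0)).add
        (((hasDerivAt_id s).pow 2).const_mul (K / 2)))).congr_deriv ?_
      simp
      ring
    refine monotoneOn_of_deriv_nonneg (convex_Icc 0 1)
      (fun s _ => (hd s).continuousAt.continuousWithinAt)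
      (fun s _ => (hd s).differentiableAt.differentiableWithinAt) fun s hs => ?_
    rw [(hd s).deriv]
    exact sub_nonneg.2 (step1 s (interior_subset hs))
  have := hmono (Set.left_mem_Icc.2 zero_le_one) (Set.right_mem_Icc.2 zero_le_one) zero_le_one
  simp only [mul_zero, mul_one] at this
  norm_num at this
  linarith

section Taylor

variable {E : Type*} [NormedAddCommGroup E] [NormedSpace ℝ E] {V : E → ℝ}

lemma hasDerivAt_comp_line (hV : ContDiff ℝ 2 V) (x t : E) (s : ℝ) :
    HasDerivAt (fun s : ℝ => V (x - s • t)) (-(fderiv ℝ V (x - s • t) t)) s := by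
  have hline : HasDerivAt (fun s : ℝ => x - s • t) (-t) s := by
    simpa using ((hasDerivAt_id s).smul_const t).const_sub x
  exact (((hV.differentiable (by norm_num)) (x - s • t)).hasFDerivAt.comp_hasDerivAt s
    hline).congr_deriv (by simp)

lemma hasDerivAt_fderiv_comp_line (hV : ContDiff ℝ 2 V) (x t : E) (s : ℝ) :
    HasDerivAt (fun s : ℝ => -(fderiv ℝ V (x - s • t) t))
      (fderiv ℝ (fderiv ℝ V) (x - s • t) t t) s := by
  have hline : HasDerivAt (fun s : ℝ => x - s • t) (-t) s := by
    simpa using ((hasDerivAt_id s).smul_const t).const_sub x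
  have hd : Differentiable ℝ (fderiv ℝ V) :=
    (hV.fderiv_right (m := 1) (by norm_num)).differentiable (by norm_num)
  have := (hd (x - s • t)).hasFDerivAt.comp_hasDerivAt s hline
  exact (this.clm_apply (hasDerivAt_const s t)).neg.congr_deriv (by simp)

lemma taylor_lower_bound (hV : ContDiff ℝ 2 V) {L : ℝ}
    (hL : ∀ x y u w, |fderiv ℝ (fderiv ℝ V) x u w - fderiv ℝ (fderiv ℝ V) y u w| ≤
      L * ‖x - y‖ * (‖u‖ * ‖w‖)) (hL0 : 0 ≤ L) (x t : E) :
    V x - fderiv ℝ V x t + (fderiv ℝ (fderiv ℝ V) x t t - L * ‖t‖ ^ 3) / 2 ≤ V (x - t) := by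
  have := second_order_lower_bound (K := fderiv ℝ (fderiv ℝ V) x t t - L * ‖t‖ ^ 3)
    (hasDerivAt_comp_line hV x t) (hasDerivAt_fderiv_comp_line hV x t) (fun s hs => by
      have h := (abs_le.1 (hL (x - s • t) x t t)).1
      have hn : ‖x - s • t - x‖ ≤ ‖t‖ := by
        rw [sub_sub_cancel_left, norm_neg, norm_smul, Real.norm_of_nonneg hs.1]
        exact mul_le_of_le_one_left (norm_nonneg t) hs.2
      have : L * ‖x - s • t - x‖ * (‖t‖ * ‖t‖) ≤ L * ‖t‖ * (‖t‖ * ‖t‖) := by gcongr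
      nlinarith)
  simpa [sub_eq_add_neg] using this

lemma taylor_upper_bound (hV : ContDiff ℝ 2 V) {M : ℝ}
    (hM : ∀ x u w, |fderiv ℝ (fderiv ℝ V) x u w| ≤ M * (‖u‖ * ‖w‖)) (x t : E) :
    V (x - t) ≤ V x - fderiv ℝ V x t + M * ‖t‖ ^ 2 / 2 := by
  have := second_order_lower_bound (K := -(M * ‖t‖ ^ 2))
    (fun s => (hasDerivAt_comp_line hV x t s).neg)
    (fun s => (hasDerivAt_fderiv_comp_line hV x t s).neg) (fun s _ => by
      have h := (abs_le.1 (hM (x - s • t) t t)).2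
      rw [sq]
      linarith)
  simp only [Pi.neg_apply, zero_smul, sub_zero, one_smul, neg_neg] at this
  linarith

/-- The error of a minimiser of a convex function, truncated at the radius `r` on which the
function is known to grow quadratically up to a linear term. -/
lemma min_norm_le_of_local_growth {g : E → ℝ} (hg : ConvexOn ℝ Set.univ g) {t : E}
    (ht : g t ≤ g 0) {a b r : ℝ} (ha : 0 < a) (hb : 0 ≤ b) (hr : 0 ≤ r)
    (hgrow : ∀ u, ‖u‖ ≤ r → g 0 - b * ‖u‖ + a * ‖u‖ ^ 2 ≤ g u) :
    min ‖t‖ r ≤ b / a := by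
  rcases eq_or_lt_of_le (norm_nonneg t) with h0 | h0
  · rw [← h0]
    exact (min_le_left _ _).trans (by positivity)
  rcases eq_or_lt_of_le hr with hr0 | hr0
  · rw [← hr0]
    exact (min_le_right _ _).trans (by positivity)
  set ρ := min ‖t‖ r with hρ
  have hρ0 : 0 < ρ := lt_min h0 hr0
  have hτ0 : 0 ≤ ρ / ‖t‖ := by positivity
  have hτ1 : ρ / ‖t‖ ≤ 1 := (div_le_one h0).2 (min_le_left _ _)
  have hu : ‖(ρ / ‖t‖) • t‖ = ρ := by
    rw [norm_smul, Real.norm_of_nonneg hτ0]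
    field_simp
  have h1 := hgrow ((ρ / ‖t‖) • t) (hu.trans_le (min_le_right _ _))
  have h2 := hg.2 (Set.mem_univ 0) (Set.mem_univ t) (sub_nonneg.2 hτ1) hτ0 (by ring)
  rw [smul_zero, zero_add] at h2
  simp only [smul_eq_mul] at h2
  rw [hu] at h1
  rw [le_div_iff₀ ha]
  have h3 : (ρ / ‖t‖) * g t ≤ (ρ / ‖t‖) * g 0 := by gcongr
  have h4 : ρ * (ρ * a) ≤ ρ * b := by nlinarith
  exact le_of_mul_le_mul_left h4 hρ0

end Taylor

section Net

variable {E : Type*} [NormedAddCommGroup E] [InnerProductSpace ℝ E] [FiniteDimensional ℝ E]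

/-- A finite family of at most `5 ^ dim E` vectors of the unit ball that computes norms up to a
factor two. -/
lemma exists_norming_finset : ∃ N : Finset E, N.card ≤ 5 ^ Module.finrank ℝ E ∧
    (∀ y ∈ N, ‖y‖ ≤ 1) ∧ ∀ w : E, ∃ y ∈ N, ‖w‖ ≤ 2 * ⟪w, y⟫ := by
  classical
  let P : Finset E → Prop := fun s => (∀ c ∈ s, ‖c‖ ≤ 2) ∧
    ∀ c ∈ s, ∀ e ∈ s, c ≠ e → 1 ≤ ‖c - e‖
  have hbdd : ∀ s, P s → s.card ≤ 5 ^ Module.finrank ℝ E :=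
    fun s hs => Besicovitch.card_le_of_separated s hs.1 hs.2
  let Q : ℕ → Prop := fun k => ∃ s, P s ∧ s.card = k
  have hQ0 : Q 0 := ⟨∅, ⟨by simp, by simp⟩, rfl⟩
  obtain ⟨s, hs, hcard⟩ : Q (Nat.findGreatest Q (5 ^ Module.finrank ℝ E)) :=
    Nat.findGreatest_spec (Nat.zero_le _) hQ0
  have hmax : ∀ x : E, ‖x‖ ≤ 2 → ∃ c ∈ s, ‖x - c‖ ≤ 1 := by
    intro x hx
    by_contra! hcon
    have hxs : x ∉ s := fun hxs => by
      have := hcon x hxs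
      simp at this
      linarith
    have hP : P (insert x s) := by
      refine ⟨fun c hc => ?_, fun c hc e he hce => ?_⟩
      · rcases Finset.mem_insert.1 hc with rfl | hc
        exacts [hx, hs.1 c hc]
      · rcases Finset.mem_insert.1 hc with hcx | hc <;>
          rcases Finset.mem_insert.1 he with hex | he
        · exact absurd (hcx.trans hex.symm) hce
        · exact hcx ▸ (hcon e he).le
        · rw [norm_sub_rev, hex]
          exact (hcon c hc).le
        · exact hs.2 c hc e he hce
    have h1 := Nat.le_findGreatest (P := Q) (hbdd _ hP) ⟨_, hP, rfl⟩
    rw [Finset.card_insert_of_notMem hxs] at h1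
    omega
  refine ⟨s.image fun c => (2⁻¹ : ℝ) • c, Finset.card_image_le.trans (hbdd s hs), ?_, fun w => ?_⟩
  · intro y hy
    obtain ⟨c, hc, rfl⟩ := Finset.mem_image.1 hy
    rw [norm_smul]
    have := hs.1 c hc
    norm_num
    linarith
  · rcases eq_or_ne w 0 with rfl | hw
    · obtain ⟨c, hc, -⟩ := hmax 0 (by simp)
      exact ⟨_, Finset.mem_image_of_mem _ hc, by simp⟩
    · have hw0 : 0 < ‖w‖ := norm_pos_iff.2 hw
      obtain ⟨c, hc, hxc⟩ := hmax ((2 * ‖w‖⁻¹) • w) (by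
        rw [norm_smul, Real.norm_of_nonneg (by positivity)]
        field_simp
        rfl)
      refine ⟨_, Finset.mem_image_of_mem _ hc, ?_⟩
      have h1 : ⟪w, (2 * ‖w‖⁻¹) • w - c⟫ ≤ ‖w‖ * 1 :=
        (real_inner_le_norm _ _).trans (by gcongr)
      rw [inner_sub_right, real_inner_smul_right, real_inner_self_eq_norm_sq] at h1
      have h2 : 2 * ‖w‖⁻¹ * ‖w‖ ^ 2 = 2 * ‖w‖ := by field_simp
      rw [real_inner_smul_right]
      linarith

lemma norm_le_two_mul_of_norming {N : Finset E} (hN : ∀ w : E, ∃ y ∈ N, ‖w‖ ≤ 2 * ⟪w, y⟫)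
    (f : E →L[ℝ] ℝ) : ∃ y ∈ N, ‖f‖ ≤ 2 * f y := by
  obtain ⟨y, hy, h⟩ := hN ((InnerProductSpace.toDual ℝ E).symm f)
  exact ⟨y, hy, by simpa using h⟩

lemma bilin_le_four_mul_of_norming {N : Finset E} (hN : ∀ w : E, ∃ y ∈ N, ‖w‖ ≤ 2 * ⟪w, y⟫)
    (B : E →L[ℝ] E →L[ℝ] ℝ) {a : ℝ} (ha : ∀ x ∈ N, ∀ y ∈ N, B x y ≤ a) (u w : E) :
    |B u w| ≤ 4 * a * (‖u‖ * ‖w‖) := by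
  obtain ⟨y, hy, h1⟩ := norm_le_two_mul_of_norming hN (B u)
  obtain ⟨x, hx, h2⟩ := norm_le_two_mul_of_norming hN (B.flip y)
  have h3 : B u y ≤ ‖B.flip y‖ * ‖u‖ := (le_abs_self _).trans ((B.flip y).le_opNorm u)
  have h4 : B.flip y x ≤ a := ha x hx y hy
  have h5 : |B u w| ≤ ‖B u‖ * ‖w‖ := (B u).le_opNorm w
  calc |B u w| ≤ ‖B u‖ * ‖w‖ := h5
    _ ≤ (4 * a * ‖u‖) * ‖w‖ := by
      gcongr
      have : ‖B.flip y‖ * ‖u‖ ≤ 2 * a * ‖u‖ := by gcongr; linarith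
      linarith
    _ = _ := by ring

end Net

open ProbabilityTheory

section Noise

variable {d : ℕ} {V : Euc d → ℝ}

lemma integrable_noiseMeasure_iff (hV : Continuous V) {f : Euc d → ℝ} :
    Integrable f (noiseMeasure V) ↔ Integrable (fun x => Real.exp (-(V x)) * f x) := by
  rw [noiseMeasure, integrable_withDensity_iff_integrable_smul' (by fun_prop) (by simp)]
  simp [ENNReal.toReal_ofReal (Real.exp_nonneg _)]

lemma integral_noiseMeasure (hV : Continuous V) (f : Euc d → ℝ) :
    ∫ x, f x ∂noiseMeasure V = ∫ x, Real.exp (-(V x)) * f x := by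
  rw [noiseMeasure, integral_withDensity_eq_integral_toReal_smul (by fun_prop) (by simp)]
  simp [ENNReal.toReal_ofReal (Real.exp_nonneg _)]

lemma integrable_exp_neg_of_integral_eq_one (h : ∫ x, Real.exp (-(V x)) = 1) :
    Integrable fun x => Real.exp (-(V x)) := by
  by_contra hcon
  rw [integral_undef hcon] at h
  exact zero_ne_one h

lemma isProbabilityMeasure_noiseMeasure (h : ∫ x, Real.exp (-(V x)) = 1) :
    IsProbabilityMeasure (noiseMeasure V) := by
  refine ⟨?_⟩
  rw [noiseMeasure, withDensity_apply _ MeasurableSet.univ, Measure.restrict_univ,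
    ← ofReal_integral_eq_lintegral_ofReal (integrable_exp_neg_of_integral_eq_one h)
      (Filter.Eventually.of_forall fun x => Real.exp_nonneg _), h, ENNReal.ofReal_one]

/-- The score of a density `e^{-V}` with bounded Hessian is sub-Gaussian. -/
lemma hasSubgaussianMGF_fderiv (hV : ContDiff ℝ 2 V) (h : ∫ x, Real.exp (-(V x)) = 1) {M : ℝ}
    (hM : ∀ x u w, |fderiv ℝ (fderiv ℝ V) x u w| ≤ M * (‖u‖ * ‖w‖)) (u : Euc d) {c : ℝ≥0}
    (hc : M * ‖u‖ ^ 2 ≤ c) :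
    HasSubgaussianMGF (fun x => fderiv ℝ V x u) c (noiseMeasure V) := by
  have hcont : Continuous V := hV.continuous
  have hcont' : Continuous fun x => fderiv ℝ V x u :=
    (hV.continuous_fderiv (by norm_num)).clm_apply continuous_const
  have hint := integrable_exp_neg_of_integral_eq_one h
  have hdom : ∀ t x, Real.exp (-(V x)) * Real.exp (t * fderiv ℝ V x u) ≤
      Real.exp (c * t ^ 2 / 2) * Real.exp (-(V (x - t • u))) := by
    intro t x
    rw [← Real.exp_add, ← Real.exp_add]
    refine Real.exp_le_exp.2 ?_
    have h1 := taylor_upper_bound hV hM x (t • u)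
    rw [map_smul, smul_eq_mul, norm_smul, mul_pow, Real.norm_eq_abs, sq_abs] at h1
    have h2 : M * ‖u‖ ^ 2 * t ^ 2 ≤ c * t ^ 2 := by gcongr
    linarith
  have hdomint : ∀ t : ℝ, Integrable
      fun x => Real.exp (c * t ^ 2 / 2) * Real.exp (-(V (x - t • u))) := fun t =>
    (hint.comp_sub_right (t • u)).const_mul _
  have hint' : ∀ t, Integrable fun x => Real.exp (-(V x)) * Real.exp (t * fderiv ℝ V x u) :=
    fun t => (hdomint t).mono' (by fun_prop) (Filter.Eventually.of_forall fun x => by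
      rw [Real.norm_of_nonneg (by positivity)]
      exact hdom t x)
  refine ⟨fun t => (integrable_noiseMeasure_iff hcont).2 (hint' t), fun t => ?_⟩
  rw [mgf, integral_noiseMeasure hcont]
  refine (integral_mono (hint' t) (hdomint t) (hdom t)).trans_eq ?_
  rw [integral_const_mul, integral_sub_right_eq_self fun x => Real.exp (-(V x)), h, mul_one]

/-- The two expressions of the Fisher information coincide. -/
lemma integral_fderiv_sq_eq (hV : ContDiff ℝ 2 V) (h : ∫ x, Real.exp (-(V x)) = 1) {M : ℝ}
    (hM : ∀ x u w, |fderiv ℝ (fderiv ℝ V) x u w| ≤ M * (‖u‖ * ‖w‖)) (u : Euc d) :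
    ∫ x, (fderiv ℝ V x u) ^ 2 ∂noiseMeasure V =
      ∫ x, fderiv ℝ (fderiv ℝ V) x u u ∂noiseMeasure V := by
  have := isProbabilityMeasure_noiseMeasure h
  have hcont : Continuous V := hV.continuous
  have hV1 : ContDiff ℝ 1 (fderiv ℝ V) := hV.fderiv_right (by norm_num)
  have hsub := hasSubgaussianMGF_fderiv hV h hM u (c := (M * ‖u‖ ^ 2).toNNReal)
    (Real.le_coe_toNNReal _)
  have hD2cont : Continuous fun x => fderiv ℝ (fderiv ℝ V) x u u :=
    ((hV1.continuous_fderiv (by norm_num)).clm_apply continuous_const).clm_apply continuous_const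
  have i1 : Integrable (fun x => fderiv ℝ V x u) (noiseMeasure V) := hsub.integrable
  have i2 : Integrable (fun x => (fderiv ℝ V x u) ^ 2) (noiseMeasure V) :=
    (hsub.memLp 2).integrable_sq
  have i3 : Integrable (fun x => fderiv ℝ (fderiv ℝ V) x u u) (noiseMeasure V) :=
    Integrable.of_bound hD2cont.aestronglyMeasurable (M * (‖u‖ * ‖u‖))
      (Filter.Eventually.of_forall fun x => hM x u u)
  rw [integrable_noiseMeasure_iff hcont] at i1 i2 i3
  have hibp := integral_bilinear_hasLineDerivAt_right_eq_neg_left_of_integrable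
    (μ := (volume : Measure (Euc d))) (B := ContinuousLinearMap.mul ℝ ℝ)
    (f := fun x => fderiv ℝ V x u) (f' := fun x => fderiv ℝ (fderiv ℝ V) x u u)
    (g := fun x => Real.exp (-(V x))) (g' := fun x => Real.exp (-(V x)) * -(fderiv ℝ V x u))
    (v := u)
    (by simpa [mul_comm] using i3)
    (by
      refine i2.neg.congr (Filter.Eventually.of_forall fun x => ?_)
      simp only [Pi.neg_apply, ContinuousLinearMap.mul_apply']
      ring)
    (by simpa [mul_comm] using i1)
    (fun x _ => by
      have hd := (hV1.differentiable (by norm_num) x).hasFDerivAt.clm_apply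
        (hasFDerivAt_const u x)
      simpa using hd.hasLineDerivAt u)
    (fun x _ => by
      have hd := (((hV.differentiable (by norm_num)) x).hasFDerivAt.neg.exp)
      simpa using hd.hasLineDerivAt u)
  rw [integral_noiseMeasure hcont, integral_noiseMeasure hcont]
  simp only [ContinuousLinearMap.mul_apply'] at hibp
  rw [← integral_neg] at hibp
  rw [← neg_inj, ← integral_neg, ← integral_neg]
  refine Eq.trans ?_ (hibp.trans ?_)
  · exact integral_congr_ae (Filter.Eventually.of_forall fun x => by simp only; ring)
  · exact integral_congr_ae (Filter.Eventually.of_forall fun x => by simp only; ring)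

/-- A lower bound on the Fisher information, as a lower bound on the mean Hessian. -/
lemma le_integral_hessian_of_le_fisher (hV : ContDiff ℝ 2 V) (h : ∫ x, Real.exp (-(V x)) = 1)
    {m M : ℝ} (hM : ∀ x u w, |fderiv ℝ (fderiv ℝ V) x u w| ≤ M * (‖u‖ * ‖w‖))
    {J : Euc d →L[ℝ] Euc d}
    (hJ : ∀ u, J u = ∫ x, ⟪gradient V x, u⟫ • gradient V x ∂noiseMeasure V)
    (hm : ∀ u : Euc d, m * ‖u‖ ^ 2 ≤ ⟪J u, u⟫) (u : Euc d) :
    m * ‖u‖ ^ 2 ≤ ∫ x, fderiv ℝ (fderiv ℝ V) x u u ∂noiseMeasure V := by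
  rw [← integral_fderiv_sq_eq hV h hM]
  refine (hm u).trans ?_
  rw [hJ u]
  by_cases hint : Integrable (fun x => ⟪gradient V x, u⟫ • gradient V x) (noiseMeasure V)
  · rw [real_inner_comm, ← integral_inner hint]
    refine (integral_congr_ae (Filter.Eventually.of_forall fun x => ?_)).le
    simp only [real_inner_smul_right, gradient]
    rw [real_inner_comm _ u, InnerProductSpace.toDual_symm_apply, sq]
  · rw [integral_undef hint, inner_zero_left]
    exact integral_nonneg fun x => sq_nonneg _

end Noise

section SubGaussian

variable {Ω : Type*} [MeasurableSpace Ω]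

lemma hasSubgaussianMGF_pi_sum {ν : Measure Ω} [IsProbabilityMeasure ν] {F : Ω → ℝ} {c : ℝ≥0}
    (hF : HasSubgaussianMGF F c ν) (n : ℕ) :
    HasSubgaussianMGF (fun x : Fin n → Ω => ∑ j, F (x j)) (n * c)
      (Measure.pi fun _ : Fin n => ν) := by
  have h := HasSubgaussianMGF.sum_of_iIndepFun (s := Finset.univ) (c := fun _ : Fin n => c)
    (iIndepFun_pi (μ := fun _ : Fin n => ν) (X := fun _ => F) fun _ => hF.aemeasurable)
    (fun j _ => HasSubgaussianMGF.of_map (X := F)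
      (measurePreserving_eval (fun _ : Fin n => ν) j).measurable.aemeasurable
      (by rwa [(measurePreserving_eval (fun _ : Fin n => ν) j).map_eq]))
  simpa using h

/-- Moments of a random vector with sub-Gaussian coordinates. -/
lemma integral_norm_rpow_le_of_hasSubgaussianMGF {μ : Measure Ω} [IsProbabilityMeasure μ] {d : ℕ}
    {G : Ω → Euc d} {c : ℝ≥0} (hc : 0 < c)
    (hG : ∀ i, HasSubgaussianMGF (fun ω => G ω i) c μ) {p : ℝ} (hp : 1 ≤ p) :
    ∃ F : Ω → ℝ, Integrable F μ ∧ (∀ ω, ‖G ω‖ ^ p ≤ F ω) ∧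
      ∫ ω, F ω ∂μ ≤ 3 * (√(2 * p * c * d)) ^ p := by
  have hp0 : 0 < p := by linarith
  have hc' : (0 : ℝ) < c := hc
  rcases Nat.eq_zero_or_pos d with rfl | hd
  · refine ⟨fun _ => 0, integrable_zero _ _ _, fun ω => ?_, ?_⟩
    · rw [Subsingleton.elim (G ω) 0, norm_zero, Real.zero_rpow hp0.ne']
    · simp only [integral_zero]
      positivity
  have hd' : (0 : ℝ) < d := Nat.cast_pos.2 hd
  set l : ℝ := √(2 * p / c) with hl
  have hl2 : c * l ^ 2 / 2 = p := by
    rw [hl, Real.sq_sqrt (by positivity)]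
    field_simp
  set K : ℝ := √(2 * p * c * d) with hK
  have hK0 : 0 < K := by positivity
  have hK2 : K ^ 2 = 2 * p * c * d := Real.sq_sqrt (by positivity)
  set E : Fin d → Ω → ℝ := fun i ω => Real.exp (l * G ω i) + Real.exp (-l * G ω i) with hE
  have hEint : ∀ i, Integrable (E i) μ := fun i =>
    ((hG i).integrable_exp_mul l).add ((hG i).integrable_exp_mul (-l))
  have hEle : ∀ i, ∫ ω, E i ω ∂μ ≤ 2 * Real.exp p := by
    intro i
    rw [integral_add ((hG i).integrable_exp_mul l) ((hG i).integrable_exp_mul (-l))]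
    have h1 := (hG i).mgf_le l
    have h2 := (hG i).mgf_le (-l)
    rw [neg_sq, hl2] at h2
    rw [hl2] at h1
    rw [mgf] at h1 h2
    linarith
  have hcoord : ∀ i ω, ((G ω i) ^ 2 / (2 * p * c)) ^ p ≤ Real.exp (-(2 * p)) * E i ω := by
    intro i ω
    set z : ℝ := |G ω i| / √(2 * p * c) with hz
    have hz0 : 0 ≤ z := by positivity
    have hz2 : (G ω i) ^ 2 / (2 * p * c) = z ^ 2 := by
      rw [hz, div_pow, sq_abs, Real.sq_sqrt (by positivity)]
    have hlz : 2 * p * z = l * |G ω i| := by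
      have h1 : l * √(2 * p * c) = 2 * p := by
        rw [hl, ← Real.sqrt_mul (by positivity),
          show 2 * p / (c : ℝ) * (2 * p * c) = (2 * p) ^ 2 by field_simp,
          Real.sqrt_sq (by positivity)]
      calc 2 * p * z = l * (√(2 * p * c) * z) := by rw [← mul_assoc, h1]
        _ = l * |G ω i| := by
          rw [hz, mul_div_cancel₀ _ (by positivity)]
    have hze : z ≤ Real.exp (z - 1) := by
      have := Real.add_one_le_exp (z - 1)
      linarith
    have habs : Real.exp (l * |G ω i|) ≤ E i ω := by
      rcases abs_cases (G ω i) with ⟨h, -⟩ | ⟨h, -⟩ <;> rw [h]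
      · exact le_add_of_nonneg_right (Real.exp_nonneg _)
      · rw [mul_neg, ← neg_mul]
        exact le_add_of_nonneg_left (Real.exp_nonneg _)
    calc ((G ω i) ^ 2 / (2 * p * c)) ^ p = z ^ (2 * p) := by
          rw [hz2, Real.rpow_mul hz0, Real.rpow_two]
      _ ≤ (Real.exp (z - 1)) ^ (2 * p) := by gcongr
      _ = Real.exp (-(2 * p)) * Real.exp (l * |G ω i|) := by
          rw [← Real.exp_mul, ← Real.exp_add, ← hlz]
          ring_nf
      _ ≤ _ := by gcongr
  have hmain : ∀ ω, ‖G ω‖ ^ p ≤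
      K ^ p * (1 + ∑ i, (d : ℝ)⁻¹ * (Real.exp (-(2 * p)) * E i ω)) := by
    intro ω
    have hW : ‖G ω‖ = K * (‖G ω‖ / K) := by field_simp
    have hW0 : 0 ≤ ‖G ω‖ / K := by positivity
    rw [hW, Real.mul_rpow hK0.le hW0]
    refine mul_le_mul_of_nonneg_left ?_ (by positivity)
    have hjensen := Real.rpow_arith_mean_le_arith_mean_rpow Finset.univ
      (fun _ : Fin d => (d : ℝ)⁻¹) (fun i => (G ω i) ^ 2 / (2 * p * c)) (fun _ _ => by positivity)
      (by simp [hd'.ne']) (fun _ _ => by positivity) hp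
    have hsum : ∑ i, (d : ℝ)⁻¹ * ((G ω i) ^ 2 / (2 * p * c)) = (‖G ω‖ / K) ^ 2 := by
      rw [div_pow, hK2, EuclideanSpace.norm_sq_eq, Finset.sum_div]
      refine Finset.sum_congr rfl fun i _ => ?_
      rw [Real.norm_eq_abs, sq_abs]
      field_simp
    rw [hsum] at hjensen
    have hle : (‖G ω‖ / K) ^ p ≤ 1 + ((‖G ω‖ / K) ^ 2) ^ p := by
      rw [← Real.rpow_pow_comm hW0]
      nlinarith [sq_nonneg ((‖G ω‖ / K) ^ p - 1)]
    refine hle.trans ?_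
    gcongr
    refine hjensen.trans (Finset.sum_le_sum fun i _ => ?_)
    gcongr
    exact hcoord i ω
  refine ⟨_, ?_, hmain, ?_⟩
  · exact ((integrable_const 1).add (integrable_finsetSum _ fun i _ =>
      ((hEint i).const_mul _).const_mul _)).const_mul _
  · rw [integral_const_mul, integral_add (integrable_const 1) (integrable_finsetSum _ fun i _ =>
      ((hEint i).const_mul _).const_mul _), integral_finsetSum _ fun i _ =>
      ((hEint i).const_mul _).const_mul _, mul_comm]
    refine mul_le_mul_of_nonneg_right ?_ (by positivity)
    have : ∀ i, ∫ ω, (d : ℝ)⁻¹ * (Real.exp (-(2 * p)) * E i ω) ∂μ ≤ (d : ℝ)⁻¹ * 2 := by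
      intro i
      rw [integral_const_mul, integral_const_mul]
      gcongr
      calc Real.exp (-(2 * p)) * ∫ ω, E i ω ∂μ ≤ Real.exp (-(2 * p)) * (2 * Real.exp p) := by
            gcongr
            exact hEle i
        _ = 2 * Real.exp (-p) := by
            rw [mul_left_comm, ← Real.exp_add]
            ring_nf
        _ ≤ 2 * 1 := by
            gcongr
            exact Real.exp_le_one_iff.2 (by linarith)
        _ = 2 := mul_one 2
    have h2 := Finset.sum_le_sum fun i (_ : i ∈ Finset.univ) => this i
    rw [Finset.sum_const, Finset.card_univ, Fintype.card_fin, nsmul_eq_mul] at h2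
    have h3 : (d : ℝ) * ((d : ℝ)⁻¹ * 2) = 2 := by field_simp
    simp only [integral_const, probReal_univ, smul_eq_mul, one_mul]
    linarith

end SubGaussian

section Deviation

/-- Uniform lower deviation bound for sums of independent random bilinear forms. -/
lemma exists_measurableSet_bilin_deviation {Ω : Type*} [MeasurableSpace Ω] {ν : Measure Ω}
    [IsProbabilityMeasure ν] {d : ℕ} {B : Ω → Euc d →L[ℝ] Euc d →L[ℝ] ℝ}
    (hB : ∀ u w, Measurable fun ω => B ω u w) {M : ℝ} (hM0 : 0 < M)
    (hM : ∀ ω u w, |B ω u w| ≤ M * (‖u‖ * ‖w‖)) {n : ℕ} (hn : 0 < n) {ε : ℝ} (hε : 0 ≤ ε) :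
    ∃ S : Set (Fin n → Ω), MeasurableSet S ∧
      (Measure.pi fun _ : Fin n => ν).real S ≤ 25 ^ d * Real.exp (-(n * ε ^ 2 / (2 * M ^ 2))) ∧
      ∀ x ∉ S, ∀ u, n * ∫ ω, B ω u u ∂ν - n * (4 * ε * ‖u‖ ^ 2) ≤ ∑ j, B (x j) u u := by
  obtain ⟨N, hcard, hN1, hN⟩ := exists_norming_finset (E := Euc d)
  rw [finrank_euclideanSpace_fin] at hcard
  have hn' : (0 : ℝ) < n := Nat.cast_pos.2 hn
  have hint : ∀ u w, Integrable (fun ω => B ω u w) ν := fun u w =>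
    Integrable.of_bound (hB u w).aestronglyMeasurable (M * (‖u‖ * ‖w‖))
      (Filter.Eventually.of_forall fun ω => hM ω u w)
  let Bmean : Euc d →L[ℝ] Euc d →L[ℝ] ℝ := (LinearMap.mk₂ ℝ (fun u w => ∫ ω, B ω u w ∂ν)
    (fun u v w => by simpa using integral_add (hint u w) (hint v w))
    (fun a u w => by simpa using integral_const_mul a fun ω => B ω u w)
    (fun u v w => by simpa using integral_add (hint u v) (hint u w))
    (fun a u w => by simpa using integral_const_mul a fun ω => B ω u w)).mkContinuous₂ M
      fun u w => by
        refine (norm_integral_le_of_norm_le_const (μ := ν)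
          (Filter.Eventually.of_forall fun ω => hM ω u w)).trans_eq ?_
        simp [mul_assoc]
  have hmean : ∀ u w, Bmean u w = ∫ ω, B ω u w ∂ν := fun u w => rfl
  let T : Euc d → Euc d → Set (Fin n → Ω) := fun u w =>
    {x | n * ε ≤ ∑ j, (-B (x j) u w - ∫ ω, -B ω u w ∂ν)}
  have hTmeas : ∀ u w, MeasurableSet (T u w) := fun u w => by
    refine measurableSet_le measurable_const (Finset.measurable_sum _ fun j _ => ?_)
    exact (((hB u w).comp (measurable_pi_apply j)).neg).sub_const _
  have hTle : ∀ u ∈ N, ∀ w ∈ N, (Measure.pi fun _ : Fin n => ν).real (T u w) ≤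
      Real.exp (-(n * ε ^ 2 / (2 * M ^ 2))) := by
    intro u hu w hw
    have hb : ∀ ω, -B ω u w ∈ Set.Icc (-M) M := fun ω => by
      have h1 : M * (‖u‖ * ‖w‖) ≤ M := mul_le_of_le_one_right hM0.le
        (mul_le_one₀ (hN1 u hu) (norm_nonneg _) (hN1 w hw))
      have h2 := abs_le.1 ((hM ω u w).trans h1)
      exact ⟨by linarith [h2.2], by linarith [h2.1]⟩
    have hsub := hasSubgaussianMGF_of_mem_Icc (μ := ν) (hB u w).neg.aemeasurable
      (Filter.Eventually.of_forall hb)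
    refine ((hasSubgaussianMGF_pi_sum hsub n).measure_ge_le
      (mul_nonneg hn'.le hε)).trans_eq ?_
    congr 1
    have hc : ((↑n * (‖M - -M‖₊ / 2) ^ 2 : ℝ≥0) : ℝ) = n * M ^ 2 := by
      push_cast
      rw [sub_neg_eq_add, Real.norm_of_nonneg (by linarith)]
      ring
    rw [hc]
    field_simp
  refine ⟨⋃ u ∈ N, ⋃ w ∈ N, T u w, ?_, ?_, fun x hx u => ?_⟩
  · exact Finset.measurableSet_biUnion _ fun u _ => Finset.measurableSet_biUnion _ fun w _ =>
      hTmeas u w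
  · set e := Real.exp (-(n * ε ^ 2 / (2 * M ^ 2))) with he
    have hcard' : (N.card : ℝ) ≤ 5 ^ d := by exact_mod_cast hcard
    calc (Measure.pi fun _ : Fin n => ν).real (⋃ u ∈ N, ⋃ w ∈ N, T u w)
        ≤ ∑ u ∈ N, ∑ w ∈ N, (Measure.pi fun _ : Fin n => ν).real (T u w) :=
          (measureReal_biUnion_finset_le _ _).trans
            (Finset.sum_le_sum fun u _ => measureReal_biUnion_finset_le _ _)
      _ ≤ ∑ u ∈ N, ∑ w ∈ N, e :=
          Finset.sum_le_sum fun u hu => Finset.sum_le_sum fun w hw => hTle u hu w hw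
      _ = N.card * N.card * e := by simp [mul_assoc]
      _ ≤ 5 ^ d * 5 ^ d * e := by gcongr
      _ = 25 ^ d * e := by rw [← mul_pow]; norm_num
  · simp only [Set.mem_iUnion, not_exists] at hx
    have happ : ∀ v w, ((n : ℝ) • Bmean - ∑ j, B (x j)) v w =
        n * ∫ ω, B ω v w ∂ν - ∑ j, B (x j) v w := fun v w => by
      simp [hmean, sum_apply]
    have h := bilin_le_four_mul_of_norming hN ((n : ℝ) • Bmean - ∑ j, B (x j))
      (a := n * ε) (fun v hv w hw => by
        have h1 : ∑ j, (-B (x j) v w - ∫ ω, -B ω v w ∂ν) < n * ε :=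
          lt_of_not_ge (hx v hv w hw)
        rw [Finset.sum_sub_distrib, Finset.sum_neg_distrib, integral_neg, Finset.sum_const,
          Finset.card_univ, Fintype.card_fin, nsmul_eq_mul] at h1
        rw [happ]
        linarith) u u
    rw [happ] at h
    have h2 := (abs_le.1 h).2
    rw [sq]
    linarith

end Deviation

section Estimator

variable {d n : ℕ} {V : Euc d → ℝ}

/-- On samples whose empirical Hessian is non-degenerate, the truncated error of the maximum
likelihood estimator is controlled by the empirical score. -/
lemma min_norm_le_of_hessian_lower_bound (hV : ContDiff ℝ 2 V)
    (hconv : ConvexOn ℝ Set.univ V) {L m : ℝ} (hL0 : 0 < L) (hm : 0 < m) (hn : 0 < n)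
    (hL : ∀ x y u w, |fderiv ℝ (fderiv ℝ V) x u w - fderiv ℝ (fderiv ℝ V) y u w| ≤
      L * ‖x - y‖ * (‖u‖ * ‖w‖)) {y : Fin n → Euc d} {t : Euc d}
    (hy : ∀ u, n * (3 / 4 * m * ‖u‖ ^ 2) ≤ ∑ j, fderiv ℝ (fderiv ℝ V) (y j) u u)
    (ht : ∑ j, V (y j - t) ≤ ∑ j, V (y j)) :
    min ‖t‖ (m / (12 * L)) ≤ 3 / (m * n) * ‖∑ j, fderiv ℝ V (y j)‖ := by
  have hn' : (0 : ℝ) < n := Nat.cast_pos.2 hn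
  have hcv : ConvexOn ℝ Set.univ fun t => ∑ j, V (y j - t) := by
    have hj : ∀ j, ConvexOn ℝ Set.univ fun t => V (y j - t) := fun j =>
      ⟨convex_univ, fun a _ b _ p q hp hq hpq => by
        have h := hconv.2 (Set.mem_univ (y j - a)) (Set.mem_univ (y j - b)) hp hq hpq
        have he : p • (y j - a) + q • (y j - b) = y j - (p • a + q • b) := by
          rw [smul_sub, smul_sub, sub_add_sub_comm, ← add_smul, hpq, one_smul]
        rwa [he] at h⟩
    refine ⟨convex_univ, fun a ha b hb p q hp hq hpq => ?_⟩
    simp only [smul_eq_mul, Finset.mul_sum, ← Finset.sum_add_distrib]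
    exact Finset.sum_le_sum fun j _ => (hj j).2 ha hb hp hq hpq
  refine (min_norm_le_of_local_growth (a := n * m / 3) (b := ‖∑ j, fderiv ℝ V (y j)‖) hcv
    (by simpa using ht) (by positivity) (norm_nonneg _) (by positivity) fun u hu => ?_).trans_eq
      (by field_simp)
  have h1 := Finset.sum_le_sum fun j (_ : j ∈ Finset.univ) => taylor_lower_bound hV hL hL0.le (y j) u
  rw [Finset.sum_add_distrib, Finset.sum_sub_distrib, ← Finset.sum_div, Finset.sum_sub_distrib,
    Finset.sum_const, Finset.card_univ, Fintype.card_fin, nsmul_eq_mul,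
    ← sum_apply] at h1
  have h2 : (∑ j, fderiv ℝ V (y j)) u ≤ ‖∑ j, fderiv ℝ V (y j)‖ * ‖u‖ :=
    (le_abs_self _).trans ((∑ j, fderiv ℝ V (y j)).le_opNorm u)
  have h3 : L * ‖u‖ ≤ m / 12 := by
    rw [le_div_iff₀ (by positivity)] at hu
    linarith
  have h4 : n * (L * ‖u‖ ^ 3) ≤ n * (m / 12 * ‖u‖ ^ 2) := by
    have : L * ‖u‖ ^ 3 = (L * ‖u‖) * ‖u‖ ^ 2 := by ring
    rw [this]
    gcongr
  have h5 := hy u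
  have h6 : 0 ≤ n * (m * ‖u‖ ^ 2) := by positivity
  simp only [sub_zero]
  linarith

end Estimator

/-- From an integral bound to a `ψ₂`-type moment bound. -/
lemma rpow_neg_half_mul_rpow_le {p I A r b : ℝ} (hp : 1 ≤ p) (hI0 : 0 ≤ I)
    (hI : I ≤ 3 * A ^ p + r ^ p * Real.exp (-b)) (hA : 0 ≤ A) (hr : 0 ≤ r) (hb : 0 < b) :
    p ^ (-(1 / 2 : ℝ)) * I ^ (1 / p) ≤ 3 * (A / √p) + r / √b := by
  have hp0 : 0 < p := by linarith
  have hsp : 0 < √p := by positivity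
  have h3 : (3 : ℝ) ≤ 3 ^ p := Real.self_le_rpow_of_one_le (by norm_num) hp
  have hle : I ≤ (3 * A + r * Real.exp (-(b / p))) ^ p := by
    calc I ≤ 3 * A ^ p + r ^ p * Real.exp (-b) := hI
      _ ≤ 3 ^ p * A ^ p + r ^ p * Real.exp (-b) := by gcongr
      _ = (3 * A) ^ p + (r * Real.exp (-(b / p))) ^ p := by
        rw [Real.mul_rpow (by norm_num) hA, Real.mul_rpow hr (Real.exp_nonneg _), ← Real.exp_mul,
          neg_mul, div_mul_cancel₀ _ hp0.ne']
      _ ≤ _ := Real.add_rpow_le_rpow_add (by positivity) (by positivity) hp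
  have hroot : I ^ (1 / p) ≤ 3 * A + r * Real.exp (-(b / p)) := by
    rw [one_div]
    exact (Real.rpow_inv_le_iff_of_pos hI0 (by positivity) hp0).2 hle
  have hexp : Real.exp (-(b / p)) ≤ √p / √b := by
    have h1 : √(b / p) ≤ Real.exp (b / p) := by
      rw [Real.sqrt_le_left (Real.exp_nonneg _), ← Real.exp_nat_mul]
      have h2 := Real.add_one_le_exp (((2 : ℕ) : ℝ) * (b / p))
      have h3 : 0 ≤ b / p := by positivity
      push_cast at h2 ⊢
      linarith
    rw [Real.sqrt_div hb.le] at h1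
    rw [Real.exp_neg]
    exact (inv_anti₀ (by positivity) h1).trans_eq (inv_div _ _)
  have hpow : p ^ (-(1 / 2 : ℝ)) = (√p)⁻¹ := by
    rw [Real.rpow_neg hp0.le, Real.sqrt_eq_rpow]
  rw [hpow]
  calc (√p)⁻¹ * I ^ (1 / p) ≤ (√p)⁻¹ * (3 * A + r * (√p / √b)) := by
        gcongr
        exact hroot.trans (by gcongr)
    _ = _ := by field_simp

/-- Corollary 3.6 / `bd_on_hat_theta_wedge_cor`: `ψ₂`-norm bound on
`‖θ̂ - θ‖ ∧ m/(12L)`. -/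
theorem stmt_13 :
    ∃ c C : ℝ, 0 < c ∧ 0 < C ∧
      ∀ (L M m : ℝ),
        0 < L → 0 < M → 0 < m →
        ∀ (d n : ℕ) (V : Euc d → ℝ) (J : Euc d →L[ℝ] Euc d)
          (hatθ : (Fin n → Euc d) → Euc d),
          0 < n →
          StrictConvexOn ℝ Set.univ V →
          ContDiff ℝ 2 V →
          (∫ x, Real.exp (-(V x)) = 1) →
          (∀ x, ‖iteratedFDeriv ℝ 2 V x‖ ≤ M) →
          (∀ x y, ‖iteratedFDeriv ℝ 2 V x - iteratedFDeriv ℝ 2 V y‖ ≤ L * ‖x - y‖) →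
          (∀ u, J u = ∫ x, ⟪gradient V x, u⟫ • gradient V x ∂ noiseMeasure V) →
          (∀ u : Euc d, m * ‖u‖ ^ 2 ≤ ⟪J u, u⟫) →
          (∀ (x : Fin n → Euc d) (θ' : Euc d),
            ∑ j, V (x j - hatθ x) ≤ ∑ j, V (x j - θ')) →
          (d : ℝ) ≤ c * (min (m / M) (m ^ 2 / (L * Real.sqrt M))) ^ 2 * n →
          ∀ θ : Euc d,
            psiNorm 2 (sampleMeasure V n θ)
                (fun x => min ‖hatθ x - θ‖ (m / (12 * L))) ≤
              C * (Real.sqrt M / m * Real.sqrt ((d : ℝ) / n) +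
                m / (L * Real.sqrt (c * (min (m / M) (m ^ 2 / (L * Real.sqrt M))) ^ 2)) *
                  (Real.sqrt n)⁻¹) := by
  refine ⟨1 / 4096, 13, by norm_num, by norm_num, ?_⟩
  intro L M m hL0 hM0 hm0 d n V J hatθ hn hconv hV hone hM hL hJ hm hmin hd θ
  have hn' : (0 : ℝ) < n := Nat.cast_pos.2 hn
  have hM' : ∀ x u w, |fderiv ℝ (fderiv ℝ V) x u w| ≤ M * (‖u‖ * ‖w‖) := fun x u w => by
    have h := (iteratedFDeriv ℝ 2 V x).le_of_opNorm_le (hM x) ![u, w]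
    simpa [iteratedFDeriv_two_apply, Fin.prod_univ_two] using h
  have hL' : ∀ x y u w, |fderiv ℝ (fderiv ℝ V) x u w - fderiv ℝ (fderiv ℝ V) y u w| ≤
      L * ‖x - y‖ * (‖u‖ * ‖w‖) := fun x y u w => by
    have h := (iteratedFDeriv ℝ 2 V x - iteratedFDeriv ℝ 2 V y).le_of_opNorm_le (hL x y) ![u, w]
    simpa [iteratedFDeriv_two_apply, Fin.prod_univ_two] using h
  have hP := isProbabilityMeasure_noiseMeasure hone
  set ν : Measure (Euc d) := (noiseMeasure V).map fun x => θ + x with hν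
  have hνprob : IsProbabilityMeasure ν := Measure.isProbabilityMeasure_map (by fun_prop)
  have hback : ν.map (fun y => y - θ) = noiseMeasure V := by
    rw [hν, Measure.map_map (by fun_prop) (by fun_prop)]
    simp [Function.comp_def]
  have hμ : sampleMeasure V n θ = Measure.pi fun _ : Fin n => ν := rfl
  rw [hμ]
  set μ : Measure (Fin n → Euc d) := Measure.pi fun _ : Fin n => ν
  have hD2cont : ∀ u w, Continuous fun x => fderiv ℝ (fderiv ℝ V) x u w := fun u w =>
    (((hV.fderiv_right (m := 1) (by norm_num)).continuous_fderiv (by norm_num)).clm_apply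
      continuous_const).clm_apply continuous_const
  set ρ : ℝ := min (m / M) (m ^ 2 / (L * √M)) with hρ
  have hρ0 : 0 < ρ := lt_min (by positivity) (by positivity)
  set r : ℝ := m / (12 * L) with hr
  have hr0 : 0 < r := by positivity
  obtain ⟨S, hS, hSle, hSc⟩ := exists_measurableSet_bilin_deviation (ν := ν)
    (B := fun y => fderiv ℝ (fderiv ℝ V) (y - θ))
    (fun u w => ((hD2cont u w).comp (continuous_sub_right θ)).measurable) hM0
    (fun y => hM' (y - θ)) hn (ε := m / 16) (by positivity)
  have hSle' : μ.real S ≤ Real.exp (-(1 / 4096 * ρ ^ 2 * n)) := by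
    refine hSle.trans ?_
    have h25 : (25 : ℝ) ^ d ≤ Real.exp (4 * d) := by
      rw [mul_comm, Real.exp_nat_mul]
      gcongr
      have h1 := Real.exp_one_gt_d9
      have h2 : Real.exp 4 = Real.exp 1 ^ 4 := by
        rw [← Real.exp_nat_mul]
        norm_num
      rw [h2]
      calc (25 : ℝ) ≤ 2.7 ^ 4 := by norm_num
        _ ≤ _ := by
          gcongr
          linarith
    have hρM : n * ρ ^ 2 ≤ n * (m / M) ^ 2 := by
      gcongr
      exact min_le_left _ _
    have hexp : n * (m / 16) ^ 2 / (2 * M ^ 2) = n * (m / M) ^ 2 / 512 := by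
      field_simp
      norm_num
    calc 25 ^ d * Real.exp (-(n * (m / 16) ^ 2 / (2 * M ^ 2)))
        ≤ Real.exp (4 * d) * Real.exp (-(n * (m / 16) ^ 2 / (2 * M ^ 2))) := by gcongr
      _ ≤ _ := by
        rw [← Real.exp_add, Real.exp_le_exp, hexp]
        have : 0 ≤ n * ρ ^ 2 := by positivity
        linarith
  set G : (Fin n → Euc d) → Euc d := fun x =>
    (InnerProductSpace.toDual ℝ (Euc d)).symm (∑ j, fderiv ℝ V (x j - θ)) with hG
  have hGcoord : ∀ x i, G x i = ∑ j, fderiv ℝ V (x j - θ) (EuclideanSpace.single i 1) := by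
    intro x i
    have h : ⟪G x, EuclideanSpace.single i (1 : ℝ)⟫ = G x i := by
      simp [EuclideanSpace.inner_single_right]
    rw [← h, hG, InnerProductSpace.toDual_symm_apply, sum_apply]
  set c₀ : ℝ≥0 := n * M.toNNReal with hc₀
  have hc₀' : (c₀ : ℝ) = n * M := by
    rw [hc₀, NNReal.coe_mul, NNReal.coe_natCast, Real.coe_toNNReal M hM0.le]
  have hc₀pos : 0 < c₀ := by
    rw [← NNReal.coe_pos, hc₀']
    positivity
  have hGsub : ∀ i, HasSubgaussianMGF (fun x => G x i) c₀ μ := by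
    intro i
    simp only [hGcoord]
    refine hasSubgaussianMGF_pi_sum
      (F := fun y => fderiv ℝ V (y - θ) (EuclideanSpace.single i 1)) ?_ n
    refine HasSubgaussianMGF.of_map (Y := fun y => y - θ)
      (X := fun y => fderiv ℝ V y (EuclideanSpace.single i 1)) (by fun_prop) ?_
    rw [hback]
    exact hasSubgaussianMGF_fderiv hV hone hM' _ (by simp [Real.coe_toNNReal M hM0.le])
  have hpt : ∀ x ∉ S, min ‖hatθ x - θ‖ r ≤ 3 / (m * n) * ‖G x‖ := by
    intro x hx
    have hGn : ‖G x‖ = ‖∑ j, fderiv ℝ V (x j - θ)‖ := LinearIsometryEquiv.norm_map _ _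
    rw [hGn]
    refine min_norm_le_of_hessian_lower_bound (y := fun j => x j - θ) hV hconv.convexOn hL0 hm0 hn
      hL' (fun u => ?_) ?_
    · have h1 := hSc x hx u
      have h2 : ∫ y, fderiv ℝ (fderiv ℝ V) (y - θ) u u ∂ν =
          ∫ y, fderiv ℝ (fderiv ℝ V) y u u ∂noiseMeasure V := by
        rw [← hback, integral_map (by fun_prop) (hD2cont u u).aestronglyMeasurable]
      have h3 := le_integral_hessian_of_le_fisher hV hone hM' hJ hm u
      rw [h2] at h1
      have h4 := mul_le_mul_of_nonneg_left h3 hn'.le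
      linarith
    · simpa using hmin x θ
  refine ciSup_le fun ⟨p, hp⟩ => ?_
  have hp0 : 0 < p := by linarith
  obtain ⟨F, hFint, hFle, hFI⟩ := integral_norm_rpow_le_of_hasSubgaussianMGF hc₀pos hGsub hp
  set κ : ℝ := 3 / (m * n) with hκ
  have hκ0 : 0 < κ := by positivity
  have hbound : ∀ x, |min ‖hatθ x - θ‖ r| ^ p ≤ κ ^ p * F x + S.indicator (fun _ => r ^ p) x := by
    intro x
    have h0 : 0 ≤ min ‖hatθ x - θ‖ r := le_min (norm_nonneg _) hr0.le
    have hF0 : 0 ≤ F x := le_trans (by positivity) (hFle x)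
    rw [abs_of_nonneg h0]
    by_cases hx : x ∈ S
    · rw [Set.indicator_of_mem hx]
      have : (min ‖hatθ x - θ‖ r) ^ p ≤ r ^ p := by
        gcongr
        exact min_le_right _ _
      have : 0 ≤ κ ^ p * F x := by positivity
      linarith
    · rw [Set.indicator_of_notMem hx, add_zero]
      calc (min ‖hatθ x - θ‖ r) ^ p ≤ (κ * ‖G x‖) ^ p := by
            gcongr
            exact hpt x hx
        _ = κ ^ p * ‖G x‖ ^ p := Real.mul_rpow hκ0.le (norm_nonneg _)
        _ ≤ _ := by
            gcongr
            exact hFle x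
  have hI : ∫ x, |min ‖hatθ x - θ‖ r| ^ p ∂μ ≤
      3 * (κ * √(2 * p * c₀ * d)) ^ p + r ^ p * Real.exp (-(1 / 4096 * ρ ^ 2 * n)) := by
    refine (integral_mono_of_nonneg (Filter.Eventually.of_forall fun x => by positivity)
      ((hFint.const_mul _).add ((integrable_const (r ^ p)).indicator hS))
      (Filter.Eventually.of_forall hbound)).trans ?_
    simp only [Pi.add_apply]
    rw [integral_add (hFint.const_mul _) ((integrable_const (r ^ p)).indicator hS),
      integral_const_mul, integral_indicator_const _ hS, smul_eq_mul,
      Real.mul_rpow hκ0.le (Real.sqrt_nonneg _), mul_comm (μ.real S), mul_left_comm]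
    gcongr
  refine (rpow_neg_half_mul_rpow_le hp (integral_nonneg fun x => by positivity) hI
    (by positivity) hr0.le (by positivity)).trans ?_
  have hsqrt1 : √(2 * p * c₀ * d) = √2 * √p * (√M * (n * √(d / n))) := by
    rw [hc₀']
    have h1 : 2 * p * (n * M) * d = 2 * p * (M * (n ^ 2 * (d / n))) := by
      field_simp
    rw [h1, Real.sqrt_mul (by positivity), Real.sqrt_mul (by positivity) p,
      Real.sqrt_mul (by positivity), Real.sqrt_mul (by positivity), Real.sqrt_sq hn'.le]
  have hsqrt2 : √(1 / 4096 * ρ ^ 2 * n) = √(1 / 4096 * ρ ^ 2) * √n :=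
    Real.sqrt_mul (by positivity) _
  have hs2 : √2 ≤ 13 / 9 := by
    rw [Real.sqrt_le_left (by norm_num)]
    norm_num
  have hγ0 : 0 < √(1 / 4096 * ρ ^ 2) := by positivity
  have hsp : 0 < √p := by positivity
  have hsn : 0 < √(n : ℝ) := by positivity
  have e1 : 3 * (κ * √(2 * p * c₀ * d) / √p) = 9 * √2 * (√M / m * √(d / n)) := by
    rw [hsqrt1, hκ]
    field_simp
    ring
  have e2 : r / √(1 / 4096 * ρ ^ 2 * n) =
      1 / 12 * (m / (L * √(1 / 4096 * ρ ^ 2)) * (√(n : ℝ))⁻¹) := by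
    rw [hsqrt2, hr]
    field_simp
  rw [e1, e2, mul_add]
  gcongr
  · linarith
  · norm_num
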